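/- arXiv:2605.09107 — 7 statements merged into one kernel-verified Lean document; each statement's English description precedes it below -/
import Mathlib

section
/- Let k be a field with char k ≠ 2, let s ≥ 0, and let d : Fin s → kˣ. Define a : Fin (s+1) → kˣ by a 0 = 2 and a (i+1) = d i, and for a subset I of Fin (s+1) set w_I = ∏_{i ∈ I} a i. Then the diagonal quadratic form of dimension 2·2^s indexed by pairs (b, I) with b ∈ Fin 2 and I ranging over the subsets of Fin (s+1) of even cardinality, with weight w_I at (b, I), is equivalent to the diagonal quadratic form of dimension 2·2^s indexed by pairs (b, I) with I of odd cardinality and weight w_I. (Equivalently, twice the virtual Pfister element ⟪2, d 0, …, d (s−1)⟫ = (⟨1⟩−⟨2⟩)∏_l(⟨1⟩−⟨d_l⟩) vanishes in the Grothendieck–Witt ring of k.) -/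
/-- The form `w ⊥ w` is equivalent to `w' ⊥ w'` whenever, up to a reindexing and up to squares,
the weights `w` are twice the weights `w'`; this is the identity `⟨a, a⟩ ≃ ⟨2a, 2a⟩`. -/
theorem QuadraticMap.equivalent_weightedSumSquares_fin_two_prod {k α β : Type*} [Field k]
    [Fintype α] [Fintype β] (h2 : (2 : k) ≠ 0) (e : β ≃ α) (w : α → k) (w' : β → k) (c : β → k)
    (hc : ∀ b, c b ≠ 0) (h : ∀ b, 2 * c b ^ 2 * w' b = w (e b)) :
    (weightedSumSquares k (fun p : Fin 2 × α => w p.2)).Equivalent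
      (weightedSumSquares k (fun p : Fin 2 × β => w' p.2)) := by
  refine ⟨⟨⟨⟨⟨fun x p => c p.2 * (x (0, e p.2) + (-1) ^ (p.1 : ℕ) * x (1, e p.2)), ?_⟩, ?_⟩,
    fun y p => (2 * c (e.symm p.2))⁻¹ *
      (y (0, e.symm p.2) + (-1) ^ (p.1 : ℕ) * y (1, e.symm p.2)), ?_, ?_⟩, ?_⟩⟩
  · intro x y
    ext p
    simp only [Pi.add_apply]
    ring
  · intro r x
    ext p
    simp only [Pi.smul_apply, smul_eq_mul, RingHom.id_apply]
    ring
  · intro x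
    ext ⟨i, a⟩
    have := hc (e.symm a)
    fin_cases i <;> simp <;> field_simp <;> ring
  · intro y
    ext ⟨i, b⟩
    have := hc b
    fin_cases i <;> simp <;> field_simp <;> ring
  · intro x
    simp only [weightedSumSquares_apply, smul_eq_mul, Fintype.sum_prod_type_right,
      Fin.sum_univ_two]
    rw [← e.sum_comp]
    refine Finset.sum_congr rfl fun b _ => ?_
    rw [← h]
    simp
    ring

/-- Toggling membership of a point exchanges the odd and the even finite subsets. -/
def Finset.oddEquivEven {ι : Type*} [DecidableEq ι] (i : ι) :
    {I : Finset ι // Odd I.card} ≃ {I : Finset ι // Even I.card} where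
  toFun I := ⟨if i ∈ I.1 then I.1.erase i else insert i I.1, by
    have := I.2
    split_ifs with hi
    · have := Finset.card_erase_add_one hi
      grind
    · rw [Finset.card_insert_of_notMem hi]
      grind⟩
  invFun I := ⟨if i ∈ I.1 then I.1.erase i else insert i I.1, by
    have := I.2
    split_ifs with hi
    · have := Finset.card_erase_add_one hi
      grind
    · rw [Finset.card_insert_of_notMem hi]
      grind⟩
  left_inv I := by
    ext1
    by_cases hi : i ∈ I.1 <;> simp [hi]
  right_inv I := by
    ext1
    by_cases hi : i ∈ I.1 <;> simp [hi]


/-- Twice the virtual Pfister element `⟪2, d 0, …, d (s-1)⟫` vanishes in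
`GW(k)`: the diagonal form of rank `2·2^s` indexed by pairs `(b, I)` with
`I ⊆ Fin (s+1)` of even cardinality and weight `∏_{i ∈ I} a i` (where `a 0 = 2`,
`a (i+1) = d i`) is equivalent to the corresponding diagonal form indexed by pairs
`(b, I)` with `I` of odd cardinality. -/
theorem stmt2 (k : Type) [Field k] (hk : ringChar k ≠ 2) (s : ℕ) (d : Fin s → kˣ) :
    letI a : Fin (s + 1) → k := Fin.cons 2 (fun i => (d i : k))
    (QuadraticMap.weightedSumSquares k
        (fun p : Fin 2 × {I : Finset (Fin (s + 1)) // Even I.card} =>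
          ∏ i ∈ p.2.val, a i)).Equivalent
      (QuadraticMap.weightedSumSquares k
        (fun p : Fin 2 × {I : Finset (Fin (s + 1)) // Odd I.card} =>
          ∏ i ∈ p.2.val, a i)) := by
  set a : Fin (s + 1) → k := Fin.cons 2 (fun i => (d i : k))
  have h2 : (2 : k) ≠ 0 := Ring.two_ne_zero hk
  refine QuadraticMap.equivalent_weightedSumSquares_fin_two_prod h2 (Finset.oddEquivEven 0)
    (fun I => ∏ i ∈ I.val, a i) (fun I => ∏ i ∈ I.val, a i)
    (fun J => if 0 ∈ J.val then 2⁻¹ else 1) ?_ ?_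
  · intro J
    split_ifs <;> simp [h2]
  · intro J
    have ha : a 0 = 2 := rfl
    by_cases hJ : 0 ∈ J.val
    · simp only [Finset.oddEquivEven, Equiv.coe_fn_mk, if_pos hJ]
      rw [← Finset.mul_prod_erase J.val a hJ, ha]
      field_simp
    · simp only [Finset.oddEquivEven, Equiv.coe_fn_mk, if_neg hJ]
      rw [Finset.prod_insert hJ, ha]
      ring
end

section
/- Cascade vanishing criterion: let R be a commutative ring, s ≥ 0, A_s = R[x₁,…,x_s]/(x₁²−1,…,x_s²−1), a : Finset (Fin s) → R, F = ∑_{I} a_I x_I, and c_J = ∑_{I ⊇ J} a_I for J ⊆ Fin s. Let ψ : A_s → B be a ring homomorphism to a commutative ring B. If ψ(c_J) · ∏_{j ∈ J}(ψ(x_j) − 1) = 0 for every proper subset J ⊊ Fin s, then ψ(F) = ψ(a_{Fin s}) · ∏_{j ∈ Fin s}(ψ(x_j) − 1). -/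
/-- The multi-affine algebra `A_s = R[x₁,…,x_s]/(x₁²-1,…,x_s²-1)`, realised as the group
algebra of `(ℤ/2)^s` over `R`. -/
abbrev MultiAffine (R : Type) [CommRing R] (s : ℕ) :=
  MonoidAlgebra R (Multiplicative (Fin s → ZMod 2))

/-- The generator `x_i` of `A_s`. -/
noncomputable def xgen (R : Type) [CommRing R] (s : ℕ) (i : Fin s) : MultiAffine R s :=
  MonoidAlgebra.of R (Multiplicative (Fin s → ZMod 2))
    (Multiplicative.ofAdd (Pi.single i 1))

/-- Möbius-type expansion of a multi-affine form around the point `(1, …, 1)`. -/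
theorem sum_mul_prod_eq_sum_superset_mul_prod_sub_one {ι B : Type*} [Fintype ι] [DecidableEq ι]
    [CommRing B] (b : Finset ι → B) (y : ι → B) :
    ∑ I : Finset ι, b I * ∏ i ∈ I, y i
      = ∑ J : Finset ι, (∑ I ∈ Finset.univ.filter (fun I => J ⊆ I), b I)
          * ∏ j ∈ J, (y j - 1) := by
  have expand (I : Finset ι) : ∏ i ∈ I, y i = ∑ J ∈ I.powerset, ∏ j ∈ J, (y j - 1) := by
    rw [← Finset.prod_add_one]
    simp
  simp_rw [expand, Finset.mul_sum, Finset.sum_mul]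
  exact Finset.sum_comm' (by simp)

/-- Cascade vanishing criterion: let `ψ : A_s → B` be a ring homomorphism,
`F = ∑_I a_I x_I`, and `c_J = ∑_{I ⊇ J} a_I`.  If
`ψ(c_J) · ∏_{j ∈ J}(ψ(x_j) - 1) = 0` for every proper subset `J ⊊ Fin s`, then
`ψ(F) = ψ(a_{Fin s}) · ∏_j (ψ(x_j) - 1)`. -/
theorem stmt7 (R : Type) [CommRing R] (s : ℕ) (a : Finset (Fin s) → R)
    (B : Type) [CommRing B] (ψ : MultiAffine R s →+* B)
    (hvanish : ∀ J : Finset (Fin s), J ≠ Finset.univ →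
      ψ (algebraMap R (MultiAffine R s)
            (∑ I ∈ Finset.univ.filter (fun I => J ⊆ I), a I))
          * ∏ j ∈ J, (ψ (xgen R s j) - 1) = 0) :
    ψ (∑ I : Finset (Fin s),
        algebraMap R (MultiAffine R s) (a I) * ∏ i ∈ I, xgen R s i)
      = ψ (algebraMap R (MultiAffine R s) (a Finset.univ))
          * ∏ j : Fin s, (ψ (xgen R s j) - 1) := by
  simp only [map_sum, map_mul, map_prod] at hvanish ⊢
  rw [sum_mul_prod_eq_sum_superset_mul_prod_sub_one,
    Finset.sum_eq_single Finset.univ (fun J _ hJ => hvanish J hJ) (by simp)]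
  simp [Finset.univ_subset_iff, Finset.filter_eq']
end

section
/- Type-A product, odd case: let k be a field with char k ≠ 2, let m be an odd positive integer whose image in k is nonzero, set c = (m−1)/2, and let d be a nonzero element of k. Let u : Fin m → k be the weight vector consisting of one entry m, c entries 2m, and c entries −2dm, and let v : Fin m → k consist of one entry m, c entries 1, and c entries −1. Then the diagonal quadratic form on k^(m·m) indexed by Fin m × Fin m with weight u i · v j at (i,j) is equivalent to the diagonal quadratic form with weights consisting of one entry 1, c entries 2, c entries −2d, and m(m−1)/2 entries 1 together with m(m−1)/2 entries −1. -/
namespace QuadraticMap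

variable {k ι κ ι' κ' : Type*} [Field k] [Fintype ι] [Fintype κ] [Fintype ι'] [Fintype κ']

/-- Reindexing a diagonal form along a bijection of the index types. -/
theorem weightedSumSquares_equivalent_of_equiv (e : ι ≃ κ) {w : ι → k} {w' : κ → k}
    (h : ∀ i, w' (e i) = w i) :
    (weightedSumSquares k w).Equivalent (weightedSumSquares k w') := by
  refine ⟨⟨LinearEquiv.funCongrLeft k k e.symm, fun x => ?_⟩⟩
  simp only [weightedSumSquares_apply]
  refine (Fintype.sum_equiv e _ _ fun i => ?_).symm
  simp [h, LinearEquiv.funCongrLeft_apply]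

/-- A diagonal form indexed by a sum type is the orthogonal sum of the two parts. -/
theorem weightedSumSquares_sumElim_equivalent_prod (w : ι → k) (w' : κ → k) :
    (weightedSumSquares k (Sum.elim w w')).Equivalent
      ((weightedSumSquares k w).prod (weightedSumSquares k w')) :=
  ⟨⟨LinearEquiv.sumArrowLequivProdArrow ι κ k k, fun x => by
    simp [weightedSumSquares_apply, Fintype.sum_sum_type]⟩⟩

theorem Equivalent.weightedSumSquares_sumElim {w₁ : ι → k} {w₂ : ι' → k} {w₁' : κ → k}
    {w₂' : κ' → k} (h : (weightedSumSquares k w₁).Equivalent (weightedSumSquares k w₂))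
    (h' : (weightedSumSquares k w₁').Equivalent (weightedSumSquares k w₂')) :
    (weightedSumSquares k (Sum.elim w₁ w₁')).Equivalent
      (weightedSumSquares k (Sum.elim w₂ w₂')) :=
  (weightedSumSquares_sumElim_equivalent_prod _ _).trans <|
    (h.prod h').trans (weightedSumSquares_sumElim_equivalent_prod _ _).symm

/-- The sum of the planes `⟨a i, -a i⟩` is the sum of as many copies of `⟨1, -1⟩`. -/
theorem weightedSumSquares_sumElim_neg_equivalent (h2 : (2 : k) ≠ 0) {a : ι → k}
    (ha : ∀ i, a i ≠ 0) :
    (weightedSumSquares k (Sum.elim a (-a))).Equivalent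
      (weightedSumSquares k (Sum.elim (fun _ : ι => (1 : k)) (fun _ : ι => (-1 : k)))) := by
  let f : (ι ⊕ ι → k) →ₗ[k] (ι ⊕ ι → k) :=
    { toFun := fun x => Sum.elim
        (fun i => (a i * (x (.inl i) + x (.inr i)) + (x (.inl i) - x (.inr i))) / 2)
        (fun i => (a i * (x (.inl i) + x (.inr i)) - (x (.inl i) - x (.inr i))) / 2)
      map_add' := fun x y => by ext (i | i) <;> simp <;> ring
      map_smul' := fun r x => by ext (i | i) <;> simp <;> ring }
  let g : (ι ⊕ ι → k) →ₗ[k] (ι ⊕ ι → k) :=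
    { toFun := fun x => Sum.elim
        (fun i => ((x (.inl i) + x (.inr i)) / a i + (x (.inl i) - x (.inr i))) / 2)
        (fun i => ((x (.inl i) + x (.inr i)) / a i - (x (.inl i) - x (.inr i))) / 2)
      map_add' := fun x y => by ext (i | i) <;> simp <;> ring
      map_smul' := fun r x => by ext (i | i) <;> simp <;> ring }
  have hfg : f ∘ₗ g = LinearMap.id := by
    refine LinearMap.ext fun x => funext ?_
    rintro (i | i) <;> have := ha i <;> simp [f, g] <;> field_simp <;> ring
  have hgf : g ∘ₗ f = LinearMap.id := by
    refine LinearMap.ext fun x => funext ?_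
    rintro (i | i) <;> have := ha i <;> simp [f, g] <;> field_simp <;> ring
  refine ⟨⟨LinearEquiv.ofLinearMap f g hfg hgf, fun x => ?_⟩⟩
  simp only [weightedSumSquares_apply, Fintype.sum_sum_type, ← Finset.sum_add_distrib]
  refine Finset.sum_congr rfl fun i _ => ?_
  simp [f]
  field_simp
  ring

end QuadraticMap


/-- Type-A product, odd case.  For `m = 2c+1` odd with `(m : k) ≠ 0` and
`d ≠ 0`, the tensor product of the diagonal forms with weights
`u = (m; 2m ×c; -2dm ×c)` and `v = (m; 1 ×c; -1 ×c)` is equivalent to the diagonal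
form with weights `(1; 2 ×c; -2d ×c; 1 ×(m(m-1)/2); -1 ×(m(m-1)/2))`
(note `m(m-1)/2 = m·c`). -/
theorem stmt8 (k : Type) [Field k] (hk : ringChar k ≠ 2)
    (m c : ℕ) (hm : m = 2 * c + 1) (hmk : (m : k) ≠ 0)
    (d : k) (hd : d ≠ 0) :
    letI u : Fin 1 ⊕ Fin c ⊕ Fin c → k :=
      Sum.elim (fun _ => (m : k))
        (Sum.elim (fun _ => 2 * (m : k)) (fun _ => -(2 * d * (m : k))))
    letI v : Fin 1 ⊕ Fin c ⊕ Fin c → k :=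
      Sum.elim (fun _ => (m : k)) (Sum.elim (fun _ => 1) (fun _ => -1))
    (QuadraticMap.weightedSumSquares k
        (fun p : (Fin 1 ⊕ Fin c ⊕ Fin c) × (Fin 1 ⊕ Fin c ⊕ Fin c) =>
          u p.1 * v p.2)).Equivalent
      (QuadraticMap.weightedSumSquares k
        (Sum.elim (fun _ : Fin 1 => (1 : k))
          (Sum.elim (fun _ : Fin c => (2 : k))
            (Sum.elim (fun _ : Fin c => -(2 * d))
              (Sum.elim (fun _ : Fin (m * c) => (1 : k))
                (fun _ : Fin (m * c) => (-1 : k))))))) := by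
  have h2 : (2 : k) ≠ 0 := Ring.two_ne_zero hk
  let U : Fin 1 ⊕ Fin c ⊕ Fin c → k :=
    Sum.elim (fun _ => (m : k)) (Sum.elim (fun _ => 2 * (m : k)) (fun _ => -(2 * d * (m : k))))
  have hU : ∀ i, U i ≠ 0 := by
    rintro (i | i | i) <;> simp [U, hmk, h2, hd]
  let e : (Fin 1 ⊕ Fin c ⊕ Fin c) × Fin c ≃ Fin (m * c) :=
    Fintype.equivFinOfCardEq (by simp [hm, two_mul, add_comm])
  let a : Fin (m * c) → k := fun j => U (e.symm j).1
  have hsplit := QuadraticMap.weightedSumSquares_equivalent_of_equiv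
    (w := fun p : (Fin 1 ⊕ Fin c ⊕ Fin c) × (Fin 1 ⊕ Fin c ⊕ Fin c) =>
      U p.1 * Sum.elim (fun _ => (m : k)) (Sum.elim (fun _ => 1) (fun _ => -1)) p.2)
    (w' := Sum.elim (fun i => U i * m) (Sum.elim a (-a)))
    ((Equiv.prodSumDistrib _ _ _).trans <| Equiv.sumCongr (Equiv.prodUnique _ _) <|
      (Equiv.prodSumDistrib _ _ _).trans (Equiv.sumCongr e e))
    (by rintro ⟨i, (j | j | j)⟩ <;> simp [a])
  have hscale : (QuadraticMap.weightedSumSquares k fun i => U i * m).Equivalent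
      (QuadraticMap.weightedSumSquares k
        (Sum.elim (fun _ => (1 : k)) (Sum.elim (fun _ => 2) (fun _ => -(2 * d))))) :=
    ⟨QuadraticForm.isometryEquivWeightedSumSquaresWeightedSumSquares
      (fun _ => Units.mk0 (m : k) hmk)
      (by rintro (i | i | i) <;> simp [U] <;> ring)⟩
  have hhyp := QuadraticMap.weightedSumSquares_sumElim_neg_equivalent h2
    (a := a) (fun j => hU _)
  refine hsplit.trans ((hscale.weightedSumSquares_sumElim hhyp).trans ?_)
  exact QuadraticMap.weightedSumSquares_equivalent_of_equiv
    ((Equiv.sumAssoc _ _ _).trans (Equiv.sumCongr (Equiv.refl _) (Equiv.sumAssoc _ _ _)))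
    (by rintro ((i | i | i) | i | i) <;> simp)
end

section
/- Type-A product, even case: let k be a field with char k ≠ 2, let m be an even positive integer whose image in k is nonzero, and let d be a nonzero element of k. Define u : Fin m → k as follows: if m ≡ 0 (mod 4), u consists of m/4 entries 2m, m/4 entries −2dm, m/4 entries 1, and m/4 entries −1; if m ≡ 2 (mod 4), u consists of one entry 1, one entry −d, (m−2)/4 entries 2m, (m−2)/4 entries −2dm, (m−2)/4 entries 1, and (m−2)/4 entries −1. Let v : Fin m → k consist of m/2 entries 1 and m/2 entries −1. Then the diagonal quadratic form indexed by Fin m × Fin m with weight u i · v j at (i,j) is equivalent to the split diagonal form with m²/2 entries 1 and m²/2 entries −1; in particular the result is independent of d. -/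
/-- The tensor product of a diagonal form with nonzero weights and a split diagonal form
is equivalent to a split diagonal form. -/
theorem weightedSumSquares_mul_split_equivalent {k ι J N : Type*} [Field k]
    [Fintype ι] [Fintype J] [Fintype N] (h2 : (2 : k) ≠ 0) (a : ι → k) (ha : ∀ i, a i ≠ 0)
    (hcard : Fintype.card ι * Fintype.card J = Fintype.card N) :
    (QuadraticMap.weightedSumSquares k (fun p : ι × (J ⊕ J) =>
        a p.1 * (Sum.elim (fun _ => (1 : k)) (fun _ => (-1 : k)) p.2))).Equivalent
      (QuadraticMap.weightedSumSquares k
        (Sum.elim (fun _ : N => (1 : k)) (fun _ : N => (-1 : k)))) := by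
  classical
  have e : N ≃ ι × J := Fintype.equivOfCardEq (by rw [Fintype.card_prod, hcard])
  -- `a (p ^ 2 - q ^ 2) = s ^ 2 - t ^ 2` for `s + t = a (p + q)` and `s - t = p - q`.
  let L : (ι × (J ⊕ J) → k) ≃ₗ[k] (N ⊕ N → k) :=
    { toFun := fun x => Sum.elim
        (fun n => (a (e n).1 * (x ((e n).1, .inl (e n).2) + x ((e n).1, .inr (e n).2))
          + (x ((e n).1, .inl (e n).2) - x ((e n).1, .inr (e n).2))) / 2)
        (fun n => (a (e n).1 * (x ((e n).1, .inl (e n).2) + x ((e n).1, .inr (e n).2))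
          - (x ((e n).1, .inl (e n).2) - x ((e n).1, .inr (e n).2))) / 2)
      invFun := fun y p => Sum.elim
        (fun j => ((y (.inl (e.symm (p.1, j))) + y (.inr (e.symm (p.1, j)))) / a p.1
          + (y (.inl (e.symm (p.1, j))) - y (.inr (e.symm (p.1, j))))) / 2)
        (fun j => ((y (.inl (e.symm (p.1, j))) + y (.inr (e.symm (p.1, j)))) / a p.1
          - (y (.inl (e.symm (p.1, j))) - y (.inr (e.symm (p.1, j))))) / 2) p.2
      map_add' := fun x y => by
        ext (n | n) <;> simp only [Sum.elim_inl, Sum.elim_inr, Pi.add_apply] <;> ring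
      map_smul' := fun c x => by
        ext (n | n) <;> simp only [Sum.elim_inl, Sum.elim_inr, Pi.smul_apply, smul_eq_mul,
          RingHom.id_apply] <;> ring
      left_inv := fun x => by
        ext ⟨i, j | j⟩ <;> have := ha i <;>
          simp only [Sum.elim_inl, Sum.elim_inr, Equiv.apply_symm_apply] <;> field_simp <;> ring
      right_inv := fun y => by
        ext (n | n) <;> have := ha (e n).1 <;>
          simp only [Sum.elim_inl, Sum.elim_inr, Prod.mk.eta, Equiv.symm_apply_apply] <;>
          field_simp <;> ring }
  refine ⟨⟨L, fun x => ?_⟩⟩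
  simp only [QuadraticMap.weightedSumSquares_apply, Fintype.sum_sum_type, Fintype.sum_prod_type,
    Sum.elim_inl, Sum.elim_inr, smul_eq_mul, ← Finset.sum_add_distrib]
  rw [← Fintype.sum_prod_type' (fun i j => a i * 1 * (x (i, .inl j) * x (i, .inl j))
      + a i * -1 * (x (i, .inr j) * x (i, .inr j))), ← e.sum_comp]
  refine Finset.sum_congr rfl fun n _ => ?_
  simp only [L, Sum.elim_inl, Sum.elim_inr]
  field_simp
  ring


/-- Type-A product, even case.  For `m` even positive with `(m : k) ≠ 0`
and `d ≠ 0`, the tensor product of the rank-`m` type-A weight vector `u` (depending on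
`m mod 4` as described) with `v = (1 ×(m/2); -1 ×(m/2))` is equivalent to the split
diagonal form with `m²/2` entries `1` and `m²/2` entries `-1`; in particular it is
independent of `d`. -/
theorem stmt9 (k : Type) [Field k] (hk : ringChar k ≠ 2)
    (m : ℕ) (hm : 0 < m) (hmk : (m : k) ≠ 0) (d : k) (hd : d ≠ 0) :
    (∀ q : ℕ, m = 4 * q →
      (QuadraticMap.weightedSumSquares k
          (fun p : (Fin q ⊕ Fin q ⊕ Fin q ⊕ Fin q) × (Fin (2 * q) ⊕ Fin (2 * q)) =>
            (Sum.elim (fun _ => 2 * (m : k))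
              (Sum.elim (fun _ => -(2 * d * (m : k)))
                (Sum.elim (fun _ => (1 : k)) (fun _ => (-1 : k)))) p.1)
            * (Sum.elim (fun _ => (1 : k)) (fun _ => (-1 : k)) p.2))).Equivalent
        (QuadraticMap.weightedSumSquares k
          (Sum.elim (fun _ : Fin (m ^ 2 / 2) => (1 : k))
            (fun _ : Fin (m ^ 2 / 2) => (-1 : k))))) ∧
    (∀ q : ℕ, m = 4 * q + 2 →
      (QuadraticMap.weightedSumSquares k
          (fun p : (Fin 1 ⊕ Fin 1 ⊕ Fin q ⊕ Fin q ⊕ Fin q ⊕ Fin q)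
              × (Fin (2 * q + 1) ⊕ Fin (2 * q + 1)) =>
            (Sum.elim (fun _ => (1 : k))
              (Sum.elim (fun _ => -d)
                (Sum.elim (fun _ => 2 * (m : k))
                  (Sum.elim (fun _ => -(2 * d * (m : k)))
                    (Sum.elim (fun _ => (1 : k)) (fun _ => (-1 : k)))))) p.1)
            * (Sum.elim (fun _ => (1 : k)) (fun _ => (-1 : k)) p.2))).Equivalent
        (QuadraticMap.weightedSumSquares k
          (Sum.elim (fun _ : Fin (m ^ 2 / 2) => (1 : k))
            (fun _ : Fin (m ^ 2 / 2) => (-1 : k))))) := by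
  have h2 : (2 : k) ≠ 0 := Ring.two_ne_zero hk
  refine ⟨fun q hq => ?_, fun q hq => ?_⟩
  · refine weightedSumSquares_mul_split_equivalent h2 _ ?_ ?_
    · rintro (_ | _ | _ | _) <;> simp [h2, hmk, hd]
    · simp only [Fintype.card_sum, Fintype.card_fin]
      rw [eq_comm, Nat.div_eq_iff_eq_mul_left two_pos ⟨8 * q ^ 2, by rw [hq]; ring⟩, hq]
      ring
  · refine weightedSumSquares_mul_split_equivalent h2 _ ?_ ?_
    · rintro (_ | _ | _ | _ | _ | _) <;> simp [h2, hmk, hd]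
    · simp only [Fintype.card_sum, Fintype.card_fin]
      rw [eq_comm, Nat.div_eq_iff_eq_mul_left two_pos
        ⟨2 * (2 * q + 1) ^ 2, by rw [hq]; ring⟩, hq]
      ring
end

section
/- Residual coefficient ring: the quotient of GW^univ by the ideal generated by 2 (= 2·⟨1⟩) and h is isomorphic as a ring to 𝔽₂[ε]/(ε²−1), where the isomorphism sends the class of ⟨2⟩ to ε; in particular this quotient is a free 𝔽₂-module of rank 2 with basis the images of ⟨1⟩ and ⟨2⟩. -/
/-- The Klein four-group, written multiplicatively; the two `ZMod 2` coordinates record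
the square classes of `-1` and of `2` respectively. -/
abbrev V4 := Multiplicative (ZMod 2 × ZMod 2)

/-- The basis element `⟨(-1)^a · 2^b⟩` of the integral group ring `ℤ[V₄]`. -/
noncomputable def gw (a b : ZMod 2) : MonoidAlgebra ℤ V4 :=
  MonoidAlgebra.of ℤ V4 (Multiplicative.ofAdd (a, b))

/-- The ideal generated by the hyperbolic relation `⟨2⟩ + ⟨-2⟩ - ⟨1⟩ - ⟨-1⟩`. -/
noncomputable def GWrel : Ideal (MonoidAlgebra ℤ V4) :=
  Ideal.span {gw 0 1 + gw 1 1 - gw 0 0 - gw 1 0}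

/-- The universal Grothendieck–Witt coefficient ring
`GW^univ = ℤ[V₄]/(⟨2⟩ + ⟨-2⟩ - ⟨1⟩ - ⟨-1⟩)`. -/
abbrev GWuniv := MonoidAlgebra ℤ V4 ⧸ GWrel

/-- The class `⟨(-1)^a · 2^b⟩` in `GW^univ`; so `gwc 0 0 = ⟨1⟩`, `gwc 1 0 = ⟨-1⟩`,
`gwc 0 1 = ⟨2⟩`, `gwc 1 1 = ⟨-2⟩`. -/
noncomputable def gwc (a b : ZMod 2) : GWuniv := Ideal.Quotient.mk GWrel (gw a b)

/-- The hyperbolic element `h = ⟨1⟩ + ⟨-1⟩` of `GW^univ`. -/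
noncomputable def hGW : GWuniv := gwc 0 0 + gwc 1 0

/-- The residual ideal `(2, h)` of `GW^univ`. -/
noncomputable def resIdeal : Ideal GWuniv := Ideal.span {(2 : GWuniv), hGW}

open Polynomial in
/-- The ring `𝔽₂[ε]/(ε² - 1)`. -/
abbrev EpsRing := (ZMod 2)[X] ⧸ (Ideal.span {X ^ 2 - 1} : Ideal (ZMod 2)[X])

/-- The class `ε` in `𝔽₂[ε]/(ε² - 1)`. -/
noncomputable def eps : EpsRing := Ideal.Quotient.mk _ Polynomial.X

theorem eps_sq : eps ^ 2 = 1 := by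
  rw [← sub_eq_zero, eps, ← map_pow, ← map_one (Ideal.Quotient.mk _), ← map_sub,
    Ideal.Quotient.eq_zero_iff_mem]
  exact Ideal.subset_span rfl

theorem two_eq_zero_epsRing : (2 : EpsRing) = 0 := by
  have h : (2 : Polynomial (ZMod 2)) = 0 := CharTwo.two_eq_zero
  rw [← map_ofNat (Ideal.Quotient.mk _) 2, h, map_zero]

theorem even_of_add_mul_eps_eq_zero (n m : ℤ) (h : (n : EpsRing) + m * eps = 0) :
    n % 2 = 0 ∧ m % 2 = 0 := by
  open Polynomial in
  have hmem : (C (m : ZMod 2) * X + C (n : ZMod 2) : (ZMod 2)[X]) ∈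
      (Ideal.span {X ^ 2 - 1} : Ideal (ZMod 2)[X]) := by
    rw [← Ideal.Quotient.eq_zero_iff_mem, ← h, eps]
    simp [add_comm]
  rw [Ideal.mem_span_singleton] at hmem
  have hmonic : (X ^ 2 - 1 : (ZMod 2)[X]).Monic := by
    simpa using monic_X_pow_sub_C (1 : ZMod 2) two_ne_zero
  have hdeg : (X ^ 2 - 1 : (ZMod 2)[X]).degree = 2 := by
    simpa using degree_X_pow_sub_C (n := 2) two_pos (1 : ZMod 2)
  have hzero : (C (m : ZMod 2) * X + C (n : ZMod 2) : (ZMod 2)[X]) = 0 := by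
    by_contra hne
    refine hmonic.not_dvd_of_degree_lt hne ?_ hmem
    rw [hdeg]
    exact degree_linear_le.trans_lt (by norm_num)
  have h₀ := congrArg (fun p => coeff p 0) hzero
  have h₁ := congrArg (fun p => coeff p 1) hzero
  simp only [coeff_add, coeff_C_mul, coeff_X_zero, coeff_X_one, coeff_C_zero, coeff_zero, mul_zero,
    mul_one, zero_add, coeff_C_succ, add_zero] at h₀ h₁
  exact ⟨Int.emod_eq_zero_of_dvd ((ZMod.intCast_zmod_eq_zero_iff_dvd n 2).mp h₀),
    Int.emod_eq_zero_of_dvd ((ZMod.intCast_zmod_eq_zero_iff_dvd m 2).mp h₁)⟩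

/-- The character `V₄ → (𝔽₂[ε]/(ε² - 1))ˣ` killing `⟨-1⟩` and sending `⟨2⟩` to `ε`. -/
noncomputable def epsChar : V4 →* EpsRing where
  toFun g := eps ^ g.toAdd.2.val
  map_one' := by simp
  map_mul' g h := by
    rw [← pow_add, toAdd_mul, Prod.snd_add, ZMod.val_add]
    exact (pow_eq_pow_mod _ eps_sq).symm

/-- The ring map `ℤ[V₄] → 𝔽₂[ε]/(ε² - 1)` induced by `epsChar`. -/
noncomputable def groupRingToEps : MonoidAlgebra ℤ V4 →+* EpsRing :=
  (MonoidAlgebra.lift ℤ EpsRing V4 epsChar).toRingHom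

theorem groupRingToEps_gw (a b : ZMod 2) : groupRingToEps (gw a b) = eps ^ b.val := by
  simp [groupRingToEps, gw, epsChar]

/-- The ring map `GW^univ → 𝔽₂[ε]/(ε² - 1)` sending `⟨-1⟩` to `1` and `⟨2⟩` to `ε`. -/
noncomputable def gwToEps : GWuniv →+* EpsRing :=
  Ideal.Quotient.lift GWrel groupRingToEps fun x hx => by
    have hle : GWrel ≤ RingHom.ker groupRingToEps := by
      rw [GWrel, Ideal.span_singleton_le_iff_mem, RingHom.mem_ker]
      simp only [map_sub, map_add, groupRingToEps_gw, ZMod.val_zero, ZMod.val_one, pow_one,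
        pow_zero]
      linear_combination (eps - 1) * two_eq_zero_epsRing
    exact hle hx

theorem gwToEps_gwc (a b : ZMod 2) : gwToEps (gwc a b) = eps ^ b.val :=
  groupRingToEps_gw a b

/-- The ring map `GW^univ/(2, h) → 𝔽₂[ε]/(ε² - 1)` sending `⟨2⟩` to `ε`. -/
noncomputable def residualToEps : GWuniv ⧸ resIdeal →+* EpsRing :=
  Ideal.Quotient.lift resIdeal gwToEps fun x hx => by
    have hle : resIdeal ≤ RingHom.ker gwToEps := by
      rw [resIdeal, Ideal.span_le, Set.insert_subset_iff, Set.singleton_subset_iff]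
      simp only [SetLike.mem_coe, RingHom.mem_ker, hGW, map_add, gwToEps_gwc, map_ofNat,
        ZMod.val_zero, pow_zero, one_add_one_eq_two, two_eq_zero_epsRing, and_self]
    exact hle hx

theorem residualToEps_gwc (a b : ZMod 2) :
    residualToEps (Ideal.Quotient.mk resIdeal (gwc a b)) = eps ^ b.val :=
  gwToEps_gwc a b

theorem gwc_zero_zero : gwc 0 0 = 1 := map_one (Ideal.Quotient.mk GWrel)

theorem two_eq_zero_residual : (2 : GWuniv ⧸ resIdeal) = 0 := by
  rw [← map_ofNat (Ideal.Quotient.mk resIdeal) 2, Ideal.Quotient.eq_zero_iff_mem]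
  exact Ideal.subset_span (Set.mem_insert _ _)

theorem mk_gwc_neg_one : Ideal.Quotient.mk resIdeal (gwc 1 0) = 1 := by
  have h : Ideal.Quotient.mk resIdeal hGW = 0 :=
    Ideal.Quotient.eq_zero_iff_mem.mpr (Ideal.subset_span (Set.mem_insert_of_mem _ rfl))
  rw [hGW, map_add, gwc_zero_zero, map_one] at h
  linear_combination h - two_eq_zero_residual

theorem gwc_mul (a b c d : ZMod 2) : gwc a b * gwc c d = gwc (a + c) (b + d) := by
  simp only [gwc, gw, ← map_mul]
  rfl

theorem mk_gwc_left (a b : ZMod 2) :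
    Ideal.Quotient.mk resIdeal (gwc a b) = Ideal.Quotient.mk resIdeal (gwc 0 b) := by
  have h : Ideal.Quotient.mk resIdeal (gwc a 0) = 1 := by
    fin_cases a
    · exact (congrArg _ gwc_zero_zero).trans (map_one _)
    · exact mk_gwc_neg_one
  rw [← one_mul (Ideal.Quotient.mk resIdeal (gwc 0 b)), ← h, ← map_mul, gwc_mul, add_zero,
    zero_add]

theorem exists_int_combination (x : GWuniv ⧸ resIdeal) : ∃ n m : ℤ,
    x = n • Ideal.Quotient.mk resIdeal (gwc 0 0)
      + m • Ideal.Quotient.mk resIdeal (gwc 0 1) := by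
  obtain ⟨y, rfl⟩ := Ideal.Quotient.mk_surjective x
  obtain ⟨z, rfl⟩ := Ideal.Quotient.mk_surjective y
  induction z using MonoidAlgebra.induction_on with
  | of g =>
    obtain ⟨a, b⟩ := g
    change ∃ n m : ℤ, Ideal.Quotient.mk resIdeal (gwc a b) = _
    rw [mk_gwc_left]
    fin_cases b
    · exact ⟨1, 0, by rw [one_smul, zero_smul, add_zero]; rfl⟩
    · exact ⟨0, 1, by rw [one_smul, zero_smul, zero_add]; rfl⟩
  | add y z hy hz =>
    obtain ⟨n, m, h⟩ := hy
    obtain ⟨n', m', h'⟩ := hz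
    refine ⟨n + n', m + m', ?_⟩
    rw [map_add, map_add, h, h', add_smul, add_smul]
    abel
  | smul r y hy =>
    obtain ⟨n, m, h⟩ := hy
    refine ⟨r * n, r * m, ?_⟩
    rw [map_zsmul, map_zsmul, h, smul_add, mul_smul, mul_smul]

theorem residualToEps_combination (n m : ℤ) :
    residualToEps (n • Ideal.Quotient.mk resIdeal (gwc 0 0)
      + m • Ideal.Quotient.mk resIdeal (gwc 0 1)) = n + m * eps := by
  rw [map_add, map_zsmul, map_zsmul, residualToEps_gwc, residualToEps_gwc]
  simp [ZMod.val_one]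

theorem int_smul_residual_eq_zero {n : ℤ} (hn : n % 2 = 0) (x : GWuniv ⧸ resIdeal) :
    n • x = 0 := by
  obtain ⟨k, rfl⟩ := Int.dvd_of_emod_eq_zero hn
  have h : x + x = 0 := by linear_combination x * two_eq_zero_residual
  rw [mul_comm, mul_smul, ofNat_zsmul, two_nsmul]
  exact (congrArg (k • ·) h).trans (smul_zero k)

theorem residualToEps_injective : Function.Injective residualToEps := by
  rw [injective_iff_map_eq_zero]
  intro x hx
  obtain ⟨n, m, rfl⟩ := exists_int_combination x
  rw [residualToEps_combination] at hx
  obtain ⟨hn, hm⟩ := even_of_add_mul_eps_eq_zero n m hx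
  rw [int_smul_residual_eq_zero hn, int_smul_residual_eq_zero hm, add_zero]

theorem residualToEps_surjective : Function.Surjective residualToEps := by
  intro y
  obtain ⟨p, rfl⟩ := Ideal.Quotient.mk_surjective y
  change _ ∈ residualToEps.rangeS
  induction p using Polynomial.induction_on' with
  | add p q hp hq =>
    rw [map_add]
    exact add_mem hp hq
  | monomial n a =>
    rw [← Polynomial.C_mul_X_pow_eq_monomial, map_mul, map_pow]
    have hX : eps ∈ residualToEps.rangeS := ⟨_, (residualToEps_gwc 0 1).trans (pow_one _)⟩
    refine mul_mem ?_ (pow_mem hX n)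
    obtain ⟨k, rfl⟩ := ZMod.natCast_zmod_surjective a
    rw [map_natCast, map_natCast]
    exact natCast_mem _ k

/-- The residual coefficient ring `GW^univ/(2, h)` is isomorphic to
`𝔽₂[ε]/(ε²-1)` via an isomorphism sending the class of `⟨2⟩` to `ε`; in particular
it is spanned over the integers by the images of `⟨1⟩` and `⟨2⟩`, whose coordinates
are well defined modulo 2 (i.e. it is free of rank 2 over `𝔽₂` on those images). -/
theorem stmt15 :
    (∃ φ : (GWuniv ⧸ resIdeal) ≃+*
        (Polynomial (ZMod 2) ⧸
          (Ideal.span {Polynomial.X ^ 2 - 1} : Ideal (Polynomial (ZMod 2)))),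
      φ (Ideal.Quotient.mk resIdeal (gwc 0 1)) =
        Ideal.Quotient.mk (Ideal.span {Polynomial.X ^ 2 - 1}) Polynomial.X) ∧
    (∀ x : GWuniv ⧸ resIdeal, ∃ n m : ℤ,
      x = n • Ideal.Quotient.mk resIdeal (gwc 0 0)
          + m • Ideal.Quotient.mk resIdeal (gwc 0 1)) ∧
    (∀ n m : ℤ,
      n • Ideal.Quotient.mk resIdeal (gwc 0 0)
          + m • Ideal.Quotient.mk resIdeal (gwc 0 1) = 0 →
        n % 2 = 0 ∧ m % 2 = 0) := by
  refine ⟨⟨RingEquiv.ofBijective residualToEps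
    ⟨residualToEps_injective, residualToEps_surjective⟩, ?_⟩, exists_int_combination, ?_⟩
  · exact (residualToEps_gwc 0 1).trans (pow_one _)
  · intro n m h
    apply even_of_add_mul_eps_eq_zero
    rw [← residualToEps_combination, h, map_zero]
end

section
/- Anisotropy induction step over Laurent series: let F be a field with char F ≠ 2, let n be a positive integer, and let w : Fin n → F have all entries nonzero. Suppose the diagonal quadratic form over F with weights w is anisotropic (its only zero is the zero vector). Then the diagonal quadratic form of dimension 2n over K = F((t)) indexed by Fin n ⊕ Fin n, with weight w i at inl i and weight −(w i)·t at inr i, is anisotropic over K. (This is the step Π_{i−1} ⟼ Π_i = Π_{i−1} ⊥ t·(−Π_{i−1}) used to prove that the Pfister form ⟨1,−2⟩⊗⟨1,−u₁⟩⊗⋯⊗⟨1,−u_s⟩ is anisotropic over ℚ((u₁))⋯((u_s)).) -/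
open HahnSeries in
theorem HahnSeries.coeff_mul_self_two_mul {F : Type*} [Semiring F] {a : F⟦ℤ⟧} {m : ℤ}
    (ha : ∀ j < m, a.coeff j = 0) : (a * a).coeff (2 * m) = a.coeff m * a.coeff m := by
  rw [coeff_mul]
  apply Finset.sum_eq_single (m, m)
  · rintro ⟨i, j⟩ hij hne
    rw [Finset.mem_antidiagonal] at hij
    obtain ⟨-, -, hsum⟩ := hij
    rcases lt_trichotomy i m with h | h | h
    · simp [ha i h]
    · exact absurd (Prod.ext h (by dsimp at hsum ⊢; omega)) hne
    · simp [ha j (by dsimp at hsum; omega)]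
  · intro h
    by_contra hne
    apply h
    rw [Finset.mem_antidiagonal]
    exact ⟨fun h0 => hne (by simp [h0]), fun h0 => hne (by simp [h0]), (two_mul m).symm⟩

open HahnSeries in
theorem HahnSeries.coeff_mul_self_of_lt {F : Type*} [Semiring F] {a : F⟦ℤ⟧} {m k : ℤ}
    (ha : ∀ j < m, a.coeff j = 0) (hk : k < 2 * m) : (a * a).coeff k = 0 := by
  rw [coeff_mul]
  apply Finset.sum_eq_zero
  rintro ⟨i, j⟩ hij
  rw [Finset.mem_antidiagonal] at hij
  obtain ⟨-, -, hsum⟩ := hij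
  rcases lt_or_ge i m with h | h
  · simp [ha i h]
  · simp [ha j (by dsimp at hsum; omega)]

theorem QuadraticMap.Anisotropic.eq_zero_of_sum_mul_self {ι F : Type*} [Fintype ι] [CommRing F]
    {w : ι → F} (hw : (QuadraticMap.weightedSumSquares F w).Anisotropic) {v : ι → F}
    (hv : ∑ i, w i * (v i * v i) = 0) (i : ι) : v i = 0 :=
  congrFun (hw v (by simpa [QuadraticMap.weightedSumSquares_apply] using hv)) i

theorem LaurentSeries.coeff_algebraMap_mul {F : Type*} [Field F] (a : F) (z : LaurentSeries F)
    (k : ℤ) : (algebraMap F (LaurentSeries F) a * z).coeff k = a * z.coeff k := by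
  rw [show algebraMap F (LaurentSeries F) a = HahnSeries.C a by
    simp [HahnSeries.algebraMap_apply'], HahnSeries.C_mul_eq_smul, HahnSeries.coeff_smul,
    smul_eq_mul]

/-- Over `F((t))`, if `w` is anisotropic over `F`, then `∑ wᵢ xᵢ² = t ∑ wᵢ yᵢ²` forces all
coefficients of the `xᵢ` and `yᵢ` to vanish, one degree after the other. -/
theorem LaurentSeries.coeff_eq_zero_of_sum_smul_mul_self {ι F : Type*} [Fintype ι] [Field F]
    {w : ι → F} (hw : (QuadraticMap.weightedSumSquares F w).Anisotropic)
    {x y : ι → LaurentSeries F}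
    (h : ∀ k : ℤ, ∑ i, w i * (x i * x i).coeff k = ∑ i, w i * (y i * y i).coeff (k - 1))
    {m : ℤ} (hx : ∀ i, ∀ j < m, (x i).coeff j = 0) (hy : ∀ i, ∀ j < m, (y i).coeff j = 0)
    (k : ℕ) : (∀ i, ∀ j < m + k, (x i).coeff j = 0) ∧ ∀ i, ∀ j < m + k, (y i).coeff j = 0 := by
  induction k with
  | zero => simpa using ⟨hx, hy⟩
  | succ k ih =>
    obtain ⟨ihx, ihy⟩ := ih
    have hx' : ∀ i, ∀ j < m + (k + 1 : ℕ), (x i).coeff j = 0 := by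
      intro i j hj
      rcases lt_or_eq_of_le (show j ≤ m + k by push_cast at hj; omega) with hlt | rfl
      · exact ihx i j hlt
      · refine hw.eq_zero_of_sum_mul_self (v := fun i => (x i).coeff (m + k)) ?_ i
        simp_rw [← HahnSeries.coeff_mul_self_two_mul (ihx _), h]
        exact Finset.sum_eq_zero fun i _ => by
          rw [HahnSeries.coeff_mul_self_of_lt (ihy i) (by omega), mul_zero]
    refine ⟨hx', fun i j hj => ?_⟩
    rcases lt_or_eq_of_le (show j ≤ m + k by push_cast at hj; omega) with hlt | rfl
    · exact ihy i j hlt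
    · refine hw.eq_zero_of_sum_mul_self (v := fun i => (y i).coeff (m + k)) ?_ i
      have h1 := h (2 * (m + k) + 1)
      rw [add_sub_cancel_right] at h1
      simp_rw [← HahnSeries.coeff_mul_self_two_mul (ihy _), ← h1]
      exact Finset.sum_eq_zero fun i _ => by
        rw [HahnSeries.coeff_mul_self_of_lt (hx' i) (by push_cast; omega), mul_zero]

/-- Anisotropy induction step over Laurent series: if the diagonal form
with nonzero weights `w : Fin n → F` is anisotropic over `F` (with `char F ≠ 2`,
`n > 0`), then the diagonal form over `K = F((t))` indexed by `Fin n ⊕ Fin n` with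
weights `w i` at `inl i` and `-(w i)·t` at `inr i` (i.e. `Π ⊥ t·(-Π)`) is anisotropic
over `K`. -/
theorem stmt17 (F : Type) [Field F] (hF : ringChar F ≠ 2)
    (n : ℕ) (hn : 0 < n) (w : Fin n → F) (hw : ∀ i, w i ≠ 0)
    (haniso : (QuadraticMap.weightedSumSquares F w).Anisotropic) :
    (QuadraticMap.weightedSumSquares (LaurentSeries F)
        (Sum.elim (fun i : Fin n => algebraMap F (LaurentSeries F) (w i))
          (fun i : Fin n =>
            -(algebraMap F (LaurentSeries F) (w i))
              * HahnSeries.single (1 : ℤ) (1 : F)))).Anisotropic := by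
  intro v hv
  have h : ∀ k : ℤ, ∑ i, w i * (v (.inl i) * v (.inl i)).coeff k =
      ∑ i, w i * (v (.inr i) * v (.inr i)).coeff (k - 1) := by
    intro k
    have hk := congrArg (fun z : LaurentSeries F => z.coeff k) hv
    simp only [QuadraticMap.weightedSumSquares_apply, Fintype.sum_sum_type, Sum.elim_inl,
      Sum.elim_inr, smul_eq_mul, neg_mul, Finset.sum_neg_distrib, mul_assoc,
      LaurentSeries.coeff_algebraMap_mul, HahnSeries.coeff_add, HahnSeries.coeff_neg, HahnSeries.coeff_sum,
      HahnSeries.coeff_single_mul, one_mul, HahnSeries.coeff_zero] at hk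
    exact add_neg_eq_zero.mp hk
  obtain ⟨m, hm⟩ := (Set.finite_range fun s => (v s).order).bddBelow
  have hlow : ∀ s, ∀ j < m, (v s).coeff j = 0 := fun s j hj =>
    HahnSeries.coeff_eq_zero_of_lt_order (hj.trans_le (hm ⟨s, rfl⟩))
  have hall := LaurentSeries.coeff_eq_zero_of_sum_smul_mul_self haniso h
    (fun i => hlow (.inl i)) fun i => hlow (.inr i)
  funext s
  ext j
  have hj : j < m + ((j - m + 1).toNat : ℤ) := by omega
  cases s with
  | inl i => exact (hall _).1 i j hj
  | inr i => exact (hall _).2 i j hj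
end

section
/- Non-injectivity witness for the coefficient map: (a) in GW^univ, the element ⟨−1⟩ + ⟨2⟩ − ⟨1⟩ − ⟨−2⟩ equals 2·(⟨2⟩ − ⟨1⟩) and is nonzero; (b) over ℚ, the diagonal quadratic form ⟨−1, 2⟩ is equivalent to the diagonal quadratic form ⟨1, −2⟩. Together these show that the specialization homomorphism from GW^univ to the Grothendieck–Witt ring of ℚ kills the nonzero element 2·(⟨2⟩ − ⟨1⟩). -/
/-- The character of `V₄` sending both `⟨-1⟩` and `⟨2⟩` to `-1`. -/
def V4.signCharacter : V4 →* ℤ where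
  toFun x := if x.toAdd.1 + x.toAdd.2 = 0 then 1 else -1
  map_one' := by decide
  map_mul' := by decide

/-- The ring homomorphism `ℤ[V₄] → ℤ` extending `V4.signCharacter`. -/
noncomputable def V4.signHom : MonoidAlgebra ℤ V4 →+* ℤ :=
  (MonoidAlgebra.lift ℤ ℤ V4 V4.signCharacter).toRingHom

theorem V4.signHom_gw (a b : ZMod 2) :
    V4.signHom (gw a b) = if a + b = 0 then 1 else -1 :=
  MonoidAlgebra.lift_of V4.signCharacter _

theorem GWrel_le_ker_signHom : GWrel ≤ RingHom.ker V4.signHom := by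
  rw [GWrel, Ideal.span_le, Set.singleton_subset_iff, SetLike.mem_coe, RingHom.mem_ker]
  simp only [map_sub, map_add, V4.signHom_gw]
  decide

theorem gwc_hyperbolic_relation : gwc 0 1 + gwc 1 1 - gwc 0 0 - gwc 1 0 = 0 := by
  simp only [gwc, ← map_add, ← map_sub]
  exact Ideal.Quotient.eq_zero_iff_mem.mpr (Ideal.subset_span rfl)

theorem gwc_witness_ne_zero : gwc 1 0 + gwc 0 1 - gwc 0 0 - gwc 1 1 ≠ 0 := by
  intro h
  simp only [gwc, ← map_add, ← map_sub] at h
  have hker := GWrel_le_ker_signHom (Ideal.Quotient.eq_zero_iff_mem.mp h)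
  rw [RingHom.mem_ker] at hker
  simp only [map_sub, map_add, V4.signHom_gw] at hker
  revert hker
  decide

/-- The form `⟨-1, 2⟩` takes the values `1` and `-2` on the orthogonal vectors `(1, 1)` and
`(2, 1)`; this is the isometry given by the coordinates in that basis. -/
def isometryEquivNegOneTwo :
    (QuadraticMap.weightedSumSquares ℚ ![(-1 : ℚ), 2]).IsometryEquiv
      (QuadraticMap.weightedSumSquares ℚ ![(1 : ℚ), -2]) where
  toFun x := ![2 * x 1 - x 0, x 0 - x 1]
  invFun y := ![y 0 + 2 * y 1, y 0 + y 1]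
  map_add' x y := by ext i; fin_cases i <;> simp <;> ring
  map_smul' c x := by ext i; fin_cases i <;> simp <;> ring
  left_inv x := by ext i; fin_cases i <;> simp <;> ring
  right_inv y := by ext i; fin_cases i <;> simp <;> ring
  map_app' x := by
    simp [QuadraticMap.weightedSumSquares_apply, Fin.sum_univ_two]
    ring

/-- Non-injectivity witness for the coefficient map: (a) in `GW^univ`,
`⟨-1⟩ + ⟨2⟩ - ⟨1⟩ - ⟨-2⟩ = 2·(⟨2⟩ - ⟨1⟩)` and this element is nonzero; (b) over `ℚ`,
the diagonal form `⟨-1, 2⟩` is equivalent to `⟨1, -2⟩` (so the specialization map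
`GW^univ → GW(ℚ)` kills the nonzero element `2·(⟨2⟩ - ⟨1⟩)`). -/
theorem stmt18 :
    (gwc 1 0 + gwc 0 1 - gwc 0 0 - gwc 1 1 = 2 * (gwc 0 1 - gwc 0 0) ∧
      gwc 1 0 + gwc 0 1 - gwc 0 0 - gwc 1 1 ≠ 0) ∧
    (QuadraticMap.weightedSumSquares ℚ ![(-1 : ℚ), 2]).Equivalent
      (QuadraticMap.weightedSumSquares ℚ ![(1 : ℚ), -2]) := by
  refine ⟨⟨?_, gwc_witness_ne_zero⟩, ⟨isometryEquivNegOneTwo⟩⟩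
  linear_combination -gwc_hyperbolic_relation
end
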